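/- arXiv:2007.00964 — 3 statements merged into one kernel-verified Lean document; each statement's English description precedes it below -/
import Mathlib

section
/- Let α not be an integer multiple of π and let Φ ∈ L^1(R) be such that φ := FΦ ∈ L^1(R) with ∫_R φ(x) dx = 1. Then for f ∈ L^1(R), the Φ_α means of the fractional Fourier integral converge to f in L^1: ‖∫_R (F_α f)(x) K_{−α}(·,x) Φ_α(εx) dx − f‖_{L^1} → 0 as ε → 0, where Φ_α(x) = Φ(x csc α). -/
open MeasureTheory Complex Real Filter
open scoped ENNReal

noncomputable def Aa (α : ℝ) : ℂ := (1 - Complex.I * (Real.cot α : ℂ)) ^ ((1 : ℂ)/2)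

noncomputable def frftKernel (α : ℝ) (x t : ℝ) : ℂ :=
  Aa α * Complex.exp (2 * Real.pi * Complex.I *
    (((t : ℂ)^2/2) * (Real.cot α : ℂ) - (x : ℂ) * (t : ℂ) * ((Real.sin α : ℂ))⁻¹
      + ((x : ℂ)^2/2) * (Real.cot α : ℂ)))

noncomputable def frft (α : ℝ) (f : ℝ → ℂ) (x : ℝ) : ℂ :=
  ∫ t : ℝ, frftKernel α x t * f t

noncomputable def classicalFT (g : ℝ → ℂ) (x : ℝ) : ℂ :=
  ∫ t : ℝ, g t * Complex.exp (-2 * Real.pi * Complex.I * (x : ℂ) * (t : ℂ))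


lemma aux_edist (g : ℝ → ℂ) (hg : MemLp g 1 volume) (h : ℝ) :
    ∫⁻ t, ‖g (h + t) - g t‖ₑ = edist (DomAddAct.mk h +ᵥ hg.toLp g) (hg.toLp g) := by
  rw [DomAddAct.mk_vadd_toLp, Lp.edist_toLp_toLp, eLpNorm_one_eq_lintegral_enorm]
  rfl

lemma aux_cont (g : ℝ → ℂ) (hg : Integrable g) :
    Continuous (fun h : ℝ => ∫⁻ t, ‖g (h + t) - g t‖ₑ) := by
  have hg' := memLp_one_iff_integrable.2 hg
  simp_rw [aux_edist g hg']
  have : Fact ((1:ℝ≥0∞) ≠ ∞) := ⟨ENNReal.one_ne_top⟩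
  have : Continuous (fun h : ℝ => DomAddAct.mk h) := DomAddAct.continuous_mk
  fun_prop

lemma aux_bound (g : ℝ → ℂ) (hg : Integrable g) (h : ℝ) :
    ∫⁻ t, ‖g (h + t) - g t‖ₑ ≤ 2 * ∫⁻ t, ‖g t‖ₑ := by
  calc ∫⁻ t, ‖g (h + t) - g t‖ₑ ≤ ∫⁻ t, (‖g (h + t)‖ₑ + ‖g t‖ₑ) :=
        lintegral_mono fun t => enorm_sub_le
    _ = (∫⁻ t, ‖g (h + t)‖ₑ) + ∫⁻ t, ‖g t‖ₑ := lintegral_add_right' _ hg.1.enorm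
    _ = 2 * ∫⁻ t, ‖g t‖ₑ := by
      rw [lintegral_add_left_eq_self (fun t => ‖g t‖ₑ) h, two_mul]

lemma aux_conv (g : ℝ → ℂ) (hg : Integrable g) (hgm : StronglyMeasurable g)
    (φ : ℝ → ℂ) (hφ : Integrable φ) (C : ℝ) (hC : ∀ x, ‖φ x‖ ≤ C) (h1 : ∫ x, φ x = 1) :
    Tendsto (fun ε : ℝ => ∫⁻ t, ‖(∫ y, g (ε * y + t) * φ y) - g t‖ₑ)
      (nhdsWithin 0 (Set.Ioi 0)) (nhds 0) := by
  have key : Tendsto (fun ε : ℝ => ∫⁻ y, (∫⁻ t, ‖g (ε * y + t) - g t‖ₑ) * ‖φ y‖ₑ)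
      (nhdsWithin 0 (Set.Ioi 0)) (nhds (∫⁻ y : ℝ, 0)) := by
    apply tendsto_lintegral_filter_of_dominated_convergence'
      (fun y => (2 * ∫⁻ t, ‖g t‖ₑ) * ‖φ y‖ₑ)
    · filter_upwards with ε
      have h := (aux_cont g hg).comp (continuous_const_mul ε)
      exact h.measurable.aemeasurable.mul hφ.1.enorm
    · filter_upwards with ε
      filter_upwards with y
      gcongr
      exact aux_bound g hg _
    · rw [lintegral_const_mul'' _ hφ.1.enorm]
      exact ENNReal.mul_ne_top (ENNReal.mul_ne_top (by simp) hg.2.ne) hφ.2.ne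
    · filter_upwards with y
      have h : Continuous (fun ε : ℝ => ∫⁻ t, ‖g (ε * y + t) - g t‖ₑ) :=
        (aux_cont g hg).comp (continuous_mul_const y)
      have h2 := (h.tendsto 0).mono_left (nhdsWithin_le_nhds (s := Set.Ioi 0))
      have h3 := ENNReal.Tendsto.mul_const (b := ‖φ y‖ₑ) h2 (Or.inr (by simp))
      simpa using h3
  rw [lintegral_zero] at key
  refine tendsto_of_tendsto_of_tendsto_of_le_of_le' tendsto_const_nhds key
    (Eventually.of_forall fun _ => zero_le) ?_
  filter_upwards [self_mem_nhdsWithin] with ε hε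
  have hε : 0 < ε := hε
  have e1 : ∀ t, (∫ y, g (ε * y + t) * φ y) - g t = ∫ y, (g (ε * y + t) - g t) * φ y := by
    intro t
    have i1 : Integrable (fun y => g (ε * y + t) * φ y) := by
      refine Integrable.mul_bdd (c := C) ?_ hφ.1 (Eventually.of_forall hC)
      exact (hg.comp_add_right t).comp_mul_left' hε.ne'
    simp_rw [sub_mul]
    rw [integral_sub i1 (hφ.const_mul _), integral_const_mul, h1, mul_one]
  calc ∫⁻ t, ‖(∫ y, g (ε * y + t) * φ y) - g t‖ₑ
      ≤ ∫⁻ t, ∫⁻ y, ‖g (ε * y + t) - g t‖ₑ * ‖φ y‖ₑ := by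
        apply lintegral_mono
        intro t
        simp only [e1]
        refine (enorm_integral_le_lintegral_enorm _).trans_eq ?_
        simp_rw [enorm_mul]
    _ = ∫⁻ y, ∫⁻ t, ‖g (ε * y + t) - g t‖ₑ * ‖φ y‖ₑ := by
        apply lintegral_lintegral_swap
        have := hgm.measurable
        refine AEMeasurable.mul ?_ (hφ.1.enorm.comp_snd)
        apply Measurable.aemeasurable
        fun_prop
    _ ≤ _ := by
        apply le_of_eq
        congr 1; ext y
        have := hgm.measurable
        rw [lintegral_mul_const _ (by fun_prop)]

lemma cFT_eq (g : ℝ → ℂ) : classicalFT g = FourierTransform.fourier g := by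
  ext w
  rw [Real.fourier_real_eq_integral_exp_smul, classicalFT]
  congr 1; ext v
  rw [smul_eq_mul, mul_comm]
  congr 2; push_cast; ring

lemma cFT_bound (g : ℝ → ℂ) (x : ℝ) : ‖classicalFT g x‖ ≤ ∫ t, ‖g t‖ := by
  refine (norm_integral_le_integral_norm _).trans_eq ?_
  congr 1; ext t
  rw [norm_mul]
  have : (-2 * Real.pi * Complex.I * (x : ℂ) * (t : ℂ)) =
    ((-2 * Real.pi * x * t : ℝ) : ℂ) * Complex.I := by push_cast; ring
  rw [this, Complex.norm_exp_ofReal_mul_I, mul_one]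

lemma cFT_swap (g h : ℝ → ℂ) (hg : Integrable g) (hh : Integrable h) :
    ∫ u, classicalFT g u * h u = ∫ s, g s * classicalFT h s := by
  rw [cFT_eq, cFT_eq]
  have := VectorFourier.integral_fourierIntegral_smul_eq_flip (L := innerₗ ℝ) (μ := volume)
    (ν := volume) Real.continuous_fourierChar continuous_inner hg hh
  rw [flip_innerₗ] at this
  exact this

lemma Aa_mul (α : ℝ) (hs : Real.sin α ≠ 0) :
    Aa α * Aa (-α) = ((|(Real.sin α)⁻¹| : ℝ) : ℂ) := by
  have h1 : Aa (-α) = (starRingEnd ℂ) (Aa α) := by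
    unfold Aa
    have hre : (1 - Complex.I * (Real.cot α : ℂ)).arg ≠ Real.pi := by
      intro h
      rw [Complex.arg_eq_pi_iff] at h
      have := h.1
      simp [-Complex.ofReal_cot] at this
      linarith
    have h2 : (1 - Complex.I * (Real.cot (-α) : ℂ)) =
        (starRingEnd ℂ) (1 - Complex.I * (Real.cot α : ℂ)) := by
      have : Real.cot (-α) = - Real.cot α := by
        rw [Real.cot_eq_cos_div_sin, Real.cot_eq_cos_div_sin]; simp [div_neg]
      rw [this]; simp [-Complex.ofReal_cot]
    rw [h2, Complex.conj_cpow _ _ hre]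
    have h4 : (starRingEnd ℂ) ((1:ℂ)/2) = 1/2 := by rw [map_div₀, map_one, map_ofNat]
    rw [h4]
  rw [h1, Complex.mul_conj]
  congr 1
  rw [Complex.normSq_eq_norm_sq]
  have h3 : (Aa α) ^ 2 = 1 - Complex.I * (Real.cot α : ℂ) := by
    unfold Aa
    rw [← Complex.cpow_nat_mul]; simp
  rw [← norm_pow, h3, ← sq_eq_sq₀ (norm_nonneg _) (abs_nonneg _), sq_abs, ← Complex.normSq_eq_norm_sq,
    Complex.normSq_apply]
  simp [-Complex.ofReal_cot]
  rw [Real.cot_eq_cos_div_sin]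
  field_simp
  linarith [Real.sin_sq_add_cos_sq α]

noncomputable def chirp (k s : ℝ) : ℂ := Complex.exp (((Real.pi * s ^ 2 * k : ℝ) : ℂ) * Complex.I)

lemma chirp_norm (k s : ℝ) : ‖chirp k s‖ = 1 := Complex.norm_exp_ofReal_mul_I _

lemma chirp_cont (k : ℝ) : Continuous (chirp k) := by unfold chirp; fun_prop

lemma chirp_neg (k s : ℝ) : chirp (-k) s * chirp k s = 1 := by
  unfold chirp
  rw [← Complex.exp_add, Complex.exp_eq_one_iff]
  exact ⟨0, by push_cast; ring⟩

lemma frft_eq (α : ℝ) (f : ℝ → ℂ) (x : ℝ) :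
    frft α f x = Aa α * chirp (Real.cot α) x *
      classicalFT (fun s => chirp (Real.cot α) s * f s) (x * (Real.sin α)⁻¹) := by
  unfold frft classicalFT
  rw [← integral_const_mul]
  congr 1; ext t
  unfold frftKernel chirp
  have : ∀ a b c d e : ℂ, a * b * (c * d * e) = a * (b * c * e) * d := by intros; ring
  rw [this, ← Complex.exp_add, ← Complex.exp_add]
  congr 3; push_cast; ring

lemma kernel_neg (α x t : ℝ) : frftKernel (-α) x t = Aa (-α) * chirp (-Real.cot α) t *
    chirp (-Real.cot α) x * Complex.exp (2 * Real.pi * Complex.I * ((x * (Real.sin α)⁻¹ : ℝ) : ℂ) * t) := by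
  unfold frftKernel chirp
  have h : Real.cot (-α) = - Real.cot α := by
    rw [Real.cot_eq_cos_div_sin, Real.cot_eq_cos_div_sin]; simp [div_neg]
  rw [mul_assoc (Aa (-α)), mul_assoc (Aa (-α)), ← Complex.exp_add, ← Complex.exp_add, h, Real.sin_neg]
  congr 2; push_cast; rw [inv_neg]; ring

lemma cFT_mod (Φ : ℝ → ℂ) (ε t s : ℝ) (hε : 0 < ε) :
    classicalFT (fun u => Complex.exp (2 * Real.pi * Complex.I * (u : ℂ) * t) * Φ (ε * u)) s =
      (ε⁻¹ : ℝ) • classicalFT Φ ((s - t) / ε) := by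
  unfold classicalFT
  have := Measure.integral_comp_mul_left (fun v : ℝ => Φ v *
    Complex.exp (-2 * Real.pi * Complex.I * (((s - t) / ε : ℝ) : ℂ) * (v : ℂ))) ε
  rw [abs_of_pos (inv_pos.2 hε)] at this
  rw [← this]
  congr 1; ext u
  have h : ∀ a b c : ℂ, a * b * c = b * (a * c) := by intros; ring
  rw [h, ← Complex.exp_add]
  congr 2
  have : (ε : ℂ) ≠ 0 := by exact_mod_cast hε.ne'
  push_cast
  field_simp
  ring

lemma means_eq (α : ℝ) (hs : Real.sin α ≠ 0) (Φ : ℝ → ℂ) (hΦ : Integrable Φ)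
    (f : ℝ → ℂ) (hf : Integrable (fun s => chirp (Real.cot α) s * f s)) (ε t : ℝ) (hε : 0 < ε) :
    (∫ x : ℝ, frft α f x * frftKernel (-α) x t * Φ ((ε * x) * (Real.sin α)⁻¹)) =
      chirp (-Real.cot α) t *
        ∫ y, (fun s => chirp (Real.cot α) s * f s) (ε * y + t) * classicalFT Φ y := by
  set g := fun s => chirp (Real.cot α) s * f s with hg
  set c := (Real.sin α)⁻¹ with hc
  have hc0 : c ≠ 0 := inv_ne_zero hs
  set h : ℝ → ℂ := fun u => Complex.exp (2 * Real.pi * Complex.I * (u : ℂ) * t) * Φ (ε * u) with hh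
  have hhint : Integrable h := by
    refine Integrable.bdd_mul (c := 1) (hΦ.comp_mul_left' hε.ne') ?_ ?_
    · apply Continuous.aestronglyMeasurable; fun_prop
    · filter_upwards with u
      have : (2 * Real.pi * Complex.I * (u : ℂ) * (t : ℂ)) =
        ((2 * Real.pi * u * t : ℝ) : ℂ) * Complex.I := by push_cast; ring
      rw [this, Complex.norm_exp_ofReal_mul_I]
  have e1 : ∀ x, frft α f x * frftKernel (-α) x t * Φ ((ε * x) * c) =
      (((|c| : ℝ) : ℂ) * chirp (-Real.cot α) t) * (fun u => classicalFT g u * h u) (x * c) := by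
    intro x
    rw [frft_eq, kernel_neg, ← Aa_mul α hs]
    simp only [hh, ← hc, ← hg]
    rw [mul_assoc ε x c]
    linear_combination (Aa α * Aa (-α) * classicalFT g (x * c) * chirp (-Real.cot α) t *
      Complex.exp (2 * Real.pi * Complex.I * ((x * c : ℝ) : ℂ) * t) * Φ (ε * (x * c))) *
      chirp_neg (Real.cot α) x
  simp_rw [e1]
  rw [integral_const_mul, Measure.integral_comp_mul_right (fun u => classicalFT g u * h u) c,
    cFT_swap g h hf hhint]
  have e2 : ∫ s, g s * classicalFT h s = ∫ y, g (ε * y + t) * classicalFT Φ y := by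
    simp_rw [hh, cFT_mod Φ ε t _ hε]
    have h1 := integral_add_right_eq_self (μ := volume)
      (fun s => g s * classicalFT Φ ((s - t) / ε)) t
    have h2 := Measure.integral_comp_mul_left
      (fun y => g (y + t) * classicalFT Φ ((y + t - t) / ε)) ε
    rw [abs_of_pos (inv_pos.2 hε), h1] at h2
    simp_rw [mul_smul_comm]
    rw [integral_smul, ← h2]
    congr 1; ext y
    congr 2
    field_simp
    ring
  rw [e2, Complex.real_smul]
  have : (((|c| : ℝ) : ℂ)) * ((|c⁻¹| : ℝ) : ℂ) = 1 := by
    rw [← Complex.ofReal_mul, ← abs_mul, mul_inv_cancel₀ hc0]; simp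
  linear_combination (chirp (-Real.cot α) t * ∫ y, g (ε * y + t) * classicalFT Φ y) * this

theorem frft_phi_means_L1_convergence (α : ℝ) (hα : ∀ n : ℤ, α ≠ n * Real.pi)
    (Φ : ℝ → ℂ) (hΦ : Integrable Φ)
    (hφint : Integrable (classicalFT Φ)) (hφ1 : ∫ x : ℝ, classicalFT Φ x = 1)
    (f : ℝ → ℂ) (hf : Integrable f) :
    Tendsto (fun ε : ℝ =>
        eLpNorm (fun t : ℝ =>
          (∫ x : ℝ, frft α f x * frftKernel (-α) x t * Φ ((ε * x) * (Real.sin α)⁻¹)) - f t)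
          1 volume)
      (nhdsWithin 0 (Set.Ioi 0)) (nhds 0) := by
  have hs : Real.sin α ≠ 0 := by
    intro h
    obtain ⟨n, hn⟩ := Real.sin_eq_zero_iff.1 h
    exact hα n hn.symm
  obtain ⟨f', hf'm, hff'⟩ := hf.1
  have hf' : Integrable f' := hf.congr hff'
  have hfr : frft α f = frft α f' := by
    ext x
    apply integral_congr_ae
    filter_upwards [hff'] with t ht
    rw [ht]
  set g := fun s => chirp (Real.cot α) s * f' s with hg
  have hgm : StronglyMeasurable g := (chirp_cont _).stronglyMeasurable.mul hf'm
  have hgi : Integrable g := hf'.bdd_mul (c := 1) (chirp_cont _).aestronglyMeasurable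
    (Eventually.of_forall fun s => (chirp_norm _ s).le)
  refine (aux_conv g hgi hgm _ hφint _ (cFT_bound Φ) hφ1).congr' ?_
  filter_upwards [self_mem_nhdsWithin] with ε hε
  rw [eLpNorm_one_eq_lintegral_enorm]
  apply lintegral_congr_ae
  filter_upwards [hff'] with t ht
  rw [hfr, means_eq α hs Φ hΦ f' hgi ε t hε, ht]
  have : f' t = chirp (-Real.cot α) t * g t := by
    simp only [hg]
    rw [← mul_assoc, chirp_neg, one_mul]
  rw [this, ← mul_sub, enorm_mul]
  have h1 : ‖chirp (-Real.cot α) t‖ₑ = 1 := by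
    rw [← ofReal_norm_eq_enorm, chirp_norm]; simp
  rw [h1, one_mul]
end

section
/- (Abel mean inversion) Let α not be an integer multiple of π and f ∈ L^1(R). Then the Abel means M_{ε}(f)(t) = ∫_R (F_α f)(x) K_{−α}(x,t) e^{−2πε|csc α||x|} dx converge to f in L^1(R) and for almost every t ∈ R as ε → 0. -/
open MeasureTheory Complex Real Filter
open scoped ENNReal

noncomputable def abelMean (α : ℝ) (f : ℝ → ℂ) (ε : ℝ) (t : ℝ) : ℂ :=
  ∫ x : ℝ, frft α f x * frftKernel (-α) x t *
    Real.exp (-2 * Real.pi * ε * |(Real.sin α)⁻¹| * |x|)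


noncomputable def PK (ε u : ℝ) : ℝ := π⁻¹ * ε * (u ^ 2 + ε ^ 2)⁻¹

lemma exp_abs_int (a b : ℝ) (ha : 0 < a) :
    ∫ x : ℝ, cexp (Complex.I * b * x) * (rexp (-a * |x|) : ℂ) = ((2 * a / (a ^ 2 + b ^ 2) : ℝ) : ℂ) := by
  have h1 : ∀ x ∈ Set.Iic (0:ℝ), cexp (Complex.I * b * x) * (rexp (-a * |x|) : ℂ)
      = cexp ((a + Complex.I * b) * x) := by
    intro x hx
    rw [abs_of_nonpos hx, Complex.ofReal_exp, ← Complex.exp_add]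
    congr 1; push_cast; ring
  have h2 : ∀ x ∈ Set.Ioi (0:ℝ), cexp (Complex.I * b * x) * (rexp (-a * |x|) : ℂ)
      = cexp ((-a + Complex.I * b) * x) := by
    intro x hx
    rw [abs_of_pos hx, Complex.ofReal_exp, ← Complex.exp_add]
    congr 1; push_cast; ring
  have r1 : 0 < ((a : ℂ) + Complex.I * b).re := by simpa
  have r2 : (-(a : ℂ) + Complex.I * b).re < 0 := by simpa
  have i1 := integrableOn_exp_mul_complex_Iic r1 0
  have i2 := integrableOn_exp_mul_complex_Ioi r2 0
  rw [← integrableOn_congr_fun h1 measurableSet_Iic] at i1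
  rw [← integrableOn_congr_fun h2 measurableSet_Ioi] at i2
  rw [← intervalIntegral.integral_Iic_add_Ioi i1 i2,
    setIntegral_congr_fun measurableSet_Iic h1, setIntegral_congr_fun measurableSet_Ioi h2,
    integral_exp_mul_complex_Iic r1, integral_exp_mul_complex_Ioi r2]
  have n1 : ((a : ℂ) + Complex.I * b) ≠ 0 := fun h => by rw [h] at r1; simp at r1
  have n2 : (-(a : ℂ) + Complex.I * b) ≠ 0 := fun h => by rw [h] at r2; simp at r2
  have n3 : ((a : ℂ) ^ 2 + b ^ 2) ≠ 0 := by
    have : (0:ℝ) < a ^ 2 + b ^ 2 := by positivity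
    exact_mod_cast this.ne'
  push_cast
  simp only [mul_zero, Complex.exp_zero]
  field_simp
  have hI := Complex.I_sq
  linear_combination (-2 * a * b ^ 2 ) * hI

lemma exp_abs_integrable (a : ℝ) (ha : 0 < a) :
    Integrable (fun x : ℝ => (rexp (-a * |x|) : ℂ)) := by
  by_contra h
  have h1 := exp_abs_int a 0 ha
  simp only [Complex.ofReal_zero, mul_zero, zero_mul, Complex.exp_zero, one_mul] at h1
  rw [integral_undef h] at h1
  have : (2 * a / (a ^ 2 + 0 ^ 2) : ℝ) ≠ 0 := by positivity
  exact this (by exact_mod_cast h1.symm)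

lemma abelMean_eq (α : ℝ) (hs : Real.sin α ≠ 0) (f : ℝ → ℂ) (hf : Integrable f) (ε : ℝ) (hε : 0 < ε)
    (t : ℝ) : abelMean α f ε t = cexp (Complex.I * ((-(π * Real.cot α * t ^ 2) : ℝ) : ℂ)) *
      ∫ s : ℝ, (PK ε (t - s) : ℂ) * (cexp (Complex.I * ((π * Real.cot α * s ^ 2 : ℝ) : ℂ)) * f s) := by
  have hc : Real.cot (-α) = - Real.cot α := by
    rw [Real.cot_eq_cos_div_sin, Real.cot_eq_cos_div_sin, Real.cos_neg, Real.sin_neg, div_neg]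
  set c := Real.cot α with hcdef
  set d := (Real.sin α)⁻¹ with hd
  have hd0 : d ≠ 0 := inv_ne_zero hs
  set a := 2 * π * ε * |d| with ha
  have ha0 : 0 < a := by have := abs_pos.2 hd0; positivity
  have key : ∀ x s : ℝ, frftKernel α x s * f s * frftKernel (-α) x t *
      (Real.exp (-2 * Real.pi * ε * |(Real.sin α)⁻¹| * |x|) : ℂ) =
      cexp (Complex.I * ((2 * π * d * (t - s) * x + (π * c * s ^ 2) + -(π * c * t ^ 2) : ℝ) : ℂ)) *
        ((rexp (-a * |x|) : ℂ) * (((|d| : ℝ) : ℂ) * f s)) := by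
    intro x s
    unfold frftKernel
    rw [hc, Real.sin_neg, ← Aa_mul α hs, ← hcdef]
    have e : -2 * Real.pi * ε * |(Real.sin α)⁻¹| * |x| = -a * |x| := by rw [ha, hd]; ring
    rw [e]
    have hdd : ((Real.sin α : ℝ) : ℂ)⁻¹ = (d : ℂ) := by rw [hd]; push_cast; rfl
    have hdd' : ((-Real.sin α : ℝ) : ℂ)⁻¹ = -(d : ℂ) := by
      rw [Complex.ofReal_neg, inv_neg, hdd]
    rw [hdd, hdd']
    have e3 : cexp (Complex.I * ((2 * π * d * (t - s) * x + (π * c * s ^ 2) + -(π * c * t ^ 2) : ℝ) : ℂ)) =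
      cexp (2 * π * Complex.I * ((s:ℂ)^2/2 * c - x * s * d + (x:ℂ)^2/2 * c)) *
      cexp (2 * π * Complex.I * ((t:ℂ)^2/2 * ((-c : ℝ):ℂ) - x * t * -d + (x:ℂ)^2/2 * ((-c : ℝ) : ℂ))) := by
      rw [← Complex.exp_add]; congr 1; push_cast; ring
    rw [e3]
    ring
  have hint : Integrable (Function.uncurry fun x s : ℝ =>
      cexp (Complex.I * ((2 * π * d * (t - s) * x + (π * c * s ^ 2) + -(π * c * t ^ 2) : ℝ) : ℂ)) *
        ((rexp (-a * |x|) : ℂ) * (((|d| : ℝ) : ℂ) * f s))) (volume.prod volume) := by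
    have h1 := (exp_abs_integrable a ha0).mul_prod (hf.const_mul ((|d| : ℝ) : ℂ))
    refine Integrable.bdd_mul (c := 1) h1 ?_ ?_
    · apply Continuous.aestronglyMeasurable
      fun_prop
    · refine Eventually.of_forall fun p => ?_
      rw [Complex.norm_exp_I_mul_ofReal]
  have step : abelMean α f ε t = ∫ x : ℝ, ∫ s : ℝ, 
      cexp (Complex.I * ((2 * π * d * (t - s) * x + (π * c * s ^ 2) + -(π * c * t ^ 2) : ℝ) : ℂ)) *
        ((rexp (-a * |x|) : ℂ) * (((|d| : ℝ) : ℂ) * f s)) := by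
    unfold abelMean frft
    congr 1; ext x
    rw [← integral_mul_const, ← integral_mul_const]
    congr 1; ext s
    exact key x s
  rw [step, integral_integral_swap hint, ← integral_const_mul]
  congr 1; ext s
  have e4 : ∀ x : ℝ, cexp (Complex.I * ((2 * π * d * (t - s) * x + (π * c * s ^ 2) + -(π * c * t ^ 2) : ℝ) : ℂ)) *
        ((rexp (-a * |x|) : ℂ) * (((|d| : ℝ) : ℂ) * f s)) =
      (cexp (Complex.I * ((2 * π * d * (t - s) : ℝ) : ℂ) * x) * (rexp (-a * |x|) : ℂ)) *
      (cexp (Complex.I * ((-(π * c * t ^ 2) : ℝ) : ℂ)) * (((|d| : ℝ) : ℂ) *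
       (cexp (Complex.I * ((π * c * s ^ 2 : ℝ) : ℂ)) * f s))) := by
    intro x
    have : cexp (Complex.I * ((2 * π * d * (t - s) * x + (π * c * s ^ 2) + -(π * c * t ^ 2) : ℝ) : ℂ)) =
      cexp (Complex.I * ((2 * π * d * (t - s) : ℝ) : ℂ) * x) * cexp (Complex.I * ((-(π * c * t ^ 2) : ℝ) : ℂ))
       * cexp (Complex.I * ((π * c * s ^ 2 : ℝ) : ℂ)) := by
      rw [← Complex.exp_add, ← Complex.exp_add]; congr 1; push_cast; ring
    rw [this]; ring
  simp_rw [e4]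
  rw [integral_mul_const, exp_abs_int _ _ ha0]
  have e5 : (2 * a / (a ^ 2 + (2 * π * d * (t - s)) ^ 2)) * |d| = PK ε (t - s) := by
    unfold PK
    rw [ha]
    have hab : d ^ 2 = |d| ^ 2 := (sq_abs d).symm
    have : (2 * π * ε * |d|) ^ 2 + (2 * π * d * (t - s)) ^ 2 = 4 * π ^ 2 * |d| ^ 2 * ((t - s) ^ 2 + ε ^ 2) := by
      rw [← hab, mul_pow _ |d|, ← hab]; ring
    rw [this]
    have h1 : 0 < |d| := abs_pos.2 hd0
    have h2 : 0 < (t - s) ^ 2 + ε ^ 2 := by positivity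
    field_simp
    ring
  rw [← e5]
  push_cast
  ring

lemma PK_nonneg {ε : ℝ} (hε : 0 < ε) (u : ℝ) : 0 ≤ PK ε u := by
  unfold PK; have := Real.pi_pos; positivity

lemma PK_cont {ε : ℝ} (hε : 0 < ε) : Continuous (PK ε) := by
  unfold PK
  refine Continuous.mul continuous_const (Continuous.inv₀ (by fun_prop) fun u => ?_)
  positivity

lemma PK_scale {ε : ℝ} (hε : 0 < ε) (v : ℝ) : ε * PK ε (ε * v) = PK 1 v := by
  unfold PK
  have : 0 < v ^ 2 + 1 := by positivity
  have h2 : (ε * v) ^ 2 + ε ^ 2 = ε ^ 2 * (v ^ 2 + 1) := by ring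
  rw [h2, one_pow]
  field_simp

lemma PK_le {ε : ℝ} (hε : 0 < ε) (u : ℝ) : PK ε u ≤ ε⁻¹ := by
  unfold PK
  have h1 : π⁻¹ ≤ 1 := inv_le_one_of_one_le₀ (by linarith [Real.pi_gt_three])
  have h0 : 0 ≤ π⁻¹ := by have := Real.pi_pos; positivity
  calc π⁻¹ * ε * (u ^ 2 + ε ^ 2)⁻¹ ≤ 1 * ε * (ε ^ 2)⁻¹ := by
        gcongr; nlinarith [sq_nonneg u]
    _ = ε⁻¹ := by field_simp

lemma PK_le' {ε : ℝ} (hε : 0 < ε) (u : ℝ) :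
    ∃ k : ℕ, |u| ≤ 2 ^ k * ε ∧ PK ε u ≤ 4 * (1 / 4) ^ k / ε := by
  rcases le_or_gt |u| ε with h | h
  · refine ⟨0, by simpa using h, (PK_le hε u).trans ?_⟩
    rw [inv_eq_one_div]; gcongr; norm_num
  · obtain ⟨n, hn1, hn2⟩ := exists_nat_pow_near (x := |u| / ε) (y := 2)
      ((one_le_div hε).2 h.le) (by norm_num)
    refine ⟨n + 1, ((div_lt_iff₀ hε).1 hn2).le, ?_⟩
    have hn3 : 2 ^ n * ε ≤ |u| := (le_div_iff₀ hε).1 hn1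
    have hsq : 4 ^ n * ε ^ 2 ≤ u ^ 2 := by
      have := pow_le_pow_left₀ (by positivity) hn3 2
      rw [sq_abs] at this
      calc (4:ℝ) ^ n * ε ^ 2 = (2 ^ n * ε) ^ 2 := by
            rw [mul_pow, ← pow_mul, mul_comm n 2, pow_mul]; norm_num
        _ ≤ _ := this
    unfold PK
    have h1 : π⁻¹ ≤ 1 := inv_le_one_of_one_le₀ (by linarith [Real.pi_gt_three])
    have h0 : 0 ≤ π⁻¹ := by have := Real.pi_pos; positivity
    calc π⁻¹ * ε * (u ^ 2 + ε ^ 2)⁻¹ ≤ 1 * ε * (4 ^ n * ε ^ 2)⁻¹ := by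
          gcongr; nlinarith [sq_nonneg ε]
      _ = 4 * (1 / 4) ^ (n + 1) / ε := by
          rw [pow_succ, one_div_pow]; field_simp; ring

lemma PK1_integrable : Integrable (PK 1) := by
  have : PK 1 = fun u => π⁻¹ * (1 + u ^ 2)⁻¹ := by
    ext u; unfold PK; rw [mul_one, one_pow, add_comm]
  rw [this]; exact integrable_inv_one_add_sq.const_mul _

lemma PK1_integral : ∫ u, PK 1 u = 1 := by
  have : PK 1 = fun u => π⁻¹ * (1 + u ^ 2)⁻¹ := by
    ext u; unfold PK; rw [mul_one, one_pow, add_comm]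
  rw [this, integral_const_mul, integral_univ_inv_one_add_sq]
  exact inv_mul_cancel₀ Real.pi_ne_zero

lemma PK_integral {ε : ℝ} (hε : 0 < ε) : ∫ u, PK ε u = 1 := by
  have h := Measure.integral_comp_mul_left (PK ε) ε
  have h2 : ∫ v, ε * PK ε (ε * v) = 1 := by simp_rw [PK_scale hε]; exact PK1_integral
  rw [integral_const_mul, h, abs_of_pos (inv_pos.2 hε), smul_eq_mul, ← mul_assoc,
    mul_inv_cancel₀ hε.ne', one_mul] at h2
  exact h2

lemma PK_integrable {ε : ℝ} (hε : 0 < ε) : Integrable (PK ε) := by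
  by_contra h
  have := PK_integral hε
  rw [integral_undef h] at this
  exact zero_ne_one this

lemma diff_bound {g : ℝ → ℂ} (hg : Integrable g) {ε : ℝ} (hε : 0 < ε) (t : ℝ) :
    ‖(∫ s, (PK ε (t - s) : ℂ) * g s) - g t‖ₑ ≤
      ∫⁻ s, ENNReal.ofReal (PK ε (t - s)) * ‖g s - g t‖ₑ := by
  have i1 : Integrable (fun s => (PK ε (t - s) : ℂ) * g s) := by
    refine Integrable.bdd_mul (c := ε⁻¹) hg ?_ ?_
    · apply Continuous.aestronglyMeasurable
      have := PK_cont hε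
      fun_prop
    · refine Eventually.of_forall fun p => ?_
      rw [Complex.norm_real, Real.norm_of_nonneg (PK_nonneg hε _)]
      exact PK_le hε _
  have i2 : Integrable (fun s => (PK ε (t - s) : ℂ) * g t) :=
    (((PK_integrable hε).comp_sub_left t).ofReal).mul_const _
  have e : g t = ∫ s, (PK ε (t - s) : ℂ) * g t := by
    rw [integral_mul_const, integral_complex_ofReal, integral_sub_left_eq_self (PK ε) volume t,
      PK_integral hε]
    simp
  calc ‖(∫ s, (PK ε (t - s) : ℂ) * g s) - g t‖ₑ
      = ‖(∫ s, (PK ε (t - s) : ℂ) * g s) - ∫ s, (PK ε (t - s) : ℂ) * g t‖ₑ := by rw [← e]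
    _ = ‖∫ s, (PK ε (t - s) : ℂ) * (g s - g t)‖ₑ := by
        rw [← integral_sub i1 i2]; simp_rw [mul_sub]
    _ ≤ ∫⁻ s, ‖(PK ε (t - s) : ℂ) * (g s - g t)‖ₑ := enorm_integral_le_lintegral_enorm _
    _ = _ := by
        congr 1; ext s
        rw [enorm_mul, ← ofReal_norm (PK ε (t - s) : ℂ), Complex.norm_real,
          Real.norm_of_nonneg (PK_nonneg hε _)]

lemma ptwise {g : ℝ → ℂ} (hg : Integrable g) (t : ℝ)
    (ht : Tendsto (fun r : ℝ => ⨍ s in Metric.closedBall t r, ‖g s - g t‖)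
      (nhdsWithin 0 (Set.Ioi 0)) (nhds 0)) :
    Tendsto (fun ε => ∫ s, (PK ε (t - s) : ℂ) * g s) (nhdsWithin 0 (Set.Ioi 0)) (nhds (g t)) := by
  set D : ℝ → ℝ := fun r : ℝ => ⨍ s in Metric.closedBall t r, ‖g s - g t‖ with hD
  have hloc : ∀ r : ℝ, IntegrableOn (fun s => g s - g t) (Metric.closedBall t r) := fun r =>
    hg.integrableOn.sub (integrableOn_const (by rw [Real.volume_closedBall]; exact ENNReal.ofReal_ne_top))
  have hD0 : ∀ r, 0 ≤ D r := fun r => by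
    simp only [hD]; rw [setAverage_eq]
    exact smul_nonneg (by positivity) (integral_nonneg fun s => norm_nonneg _)
  have hDe : ∀ r, 0 < r → ∫ s in Metric.closedBall t r, ‖g s - g t‖ = 2 * r * D r := by
    intro r hr
    simp only [hD]
    rw [setAverage_eq, Measure.real, Real.volume_closedBall, ENNReal.toReal_ofReal (by positivity),
      smul_eq_mul]
    field_simp
  have hDl : ∀ r, 0 < r → ∫⁻ s in Metric.closedBall t r, ‖g s - g t‖ₑ =
      ENNReal.ofReal (2 * r * D r) := by
    intro r hr
    rw [← hDe r hr]
    exact (ofReal_integral_norm_eq_lintegral_enorm (hloc r)).symm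
  obtain ⟨B, hB⟩ : ∃ B, ∀ r, 0 < r → D r ≤ B := by
    have h1 : ∀ᶠ r in nhdsWithin (0:ℝ) (Set.Ioi 0), D r < 1 := ht.eventually_lt_const one_pos
    obtain ⟨δ, hδ, hδ1⟩ := mem_nhdsGT_iff_exists_Ioc_subset.1 h1
    have hδ0 : (0:ℝ) < δ := hδ
    refine ⟨max 1 ((∫ s, ‖g s‖) / (2 * δ) + ‖g t‖), fun r hr => ?_⟩
    rcases le_or_gt r δ with h | h
    · exact (le_of_lt (hδ1 ⟨hr, h⟩)).trans (le_max_left _ _)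
    · refine le_trans ?_ (le_max_right _ _)
      have : 2 * r * D r ≤ (∫ s, ‖g s‖) + 2 * r * ‖g t‖ := by
        rw [← hDe r hr]
        calc ∫ s in Metric.closedBall t r, ‖g s - g t‖ 
            ≤ ∫ s in Metric.closedBall t r, (‖g s‖ + ‖g t‖) := by
              refine setIntegral_mono (hloc r).norm ?_ fun s => norm_sub_le _ _
              exact hg.norm.integrableOn.add (integrableOn_const (by rw [Real.volume_closedBall]; exact ENNReal.ofReal_ne_top))
          _ = (∫ s in Metric.closedBall t r, ‖g s‖) + 2 * r * ‖g t‖ := by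
              rw [integral_add hg.norm.integrableOn (integrableOn_const (by rw [Real.volume_closedBall]; exact ENNReal.ofReal_ne_top))]
              congr 1
              rw [setIntegral_const, Measure.real, Real.volume_closedBall,
                ENNReal.toReal_ofReal (by positivity), smul_eq_mul]
          _ ≤ _ := by
              gcongr
              · exact Eventually.of_forall fun s => norm_nonneg _
              · exact hg.norm
              · exact Measure.restrict_le_self
      have h3 : D r ≤ (∫ s, ‖g s‖) / (2 * r) + ‖g t‖ := by
        rw [← sub_le_iff_le_add, le_div_iff₀ (by positivity)]; linarith
      refine h3.trans ?_
      have : 0 ≤ ∫ s, ‖g s‖ := integral_nonneg fun s => norm_nonneg _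
      gcongr
  have hsum : Summable (fun k : ℕ => 8 * (1 / 2 : ℝ) ^ k * B) :=
    (summable_geometric_two.mul_left 8).mul_right B
  have hlim : Tendsto (fun ε : ℝ => ∑' k : ℕ, 8 * (1 / 2 : ℝ) ^ k * D (2 ^ k * ε))
      (nhdsWithin 0 (Set.Ioi 0)) (nhds 0) := by
    have := tendsto_tsum_of_dominated_convergence (𝓕 := nhdsWithin (0:ℝ) (Set.Ioi 0))
      (f := fun ε (k : ℕ) => 8 * (1 / 2 : ℝ) ^ k * D (2 ^ k * ε)) (g := fun _ => 0) hsum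
      (fun k => ?_) ?_
    · simpa using this
    · have h2 : Tendsto (fun ε : ℝ => 2 ^ k * ε) (nhdsWithin 0 (Set.Ioi 0)) (nhdsWithin 0 (Set.Ioi 0)) := by
        refine tendsto_nhdsWithin_iff.2 ⟨?_, ?_⟩
        · refine Tendsto.mono_left ?_ nhdsWithin_le_nhds
          have : Continuous fun ε : ℝ => (2:ℝ) ^ k * ε := by fun_prop
          simpa using this.tendsto 0
        · filter_upwards [self_mem_nhdsWithin] with ε (hε : 0 < ε)
          exact Set.mem_Ioi.2 (by positivity)
      simpa using (ht.comp h2).const_mul (8 * (1 / 2 : ℝ) ^ k)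
    · filter_upwards [self_mem_nhdsWithin] with ε (hε : 0 < ε) k
      have h0 := hD0 (2 ^ k * ε)
      rw [Real.norm_of_nonneg (by positivity)]
      gcongr
      exact hB _ (by positivity)
  have hbound : ∀ ε : ℝ, 0 < ε → ‖(∫ s, (PK ε (t - s) : ℂ) * g s) - g t‖ₑ ≤
      ENNReal.ofReal (∑' k : ℕ, 8 * (1 / 2 : ℝ) ^ k * D (2 ^ k * ε)) := by
    intro ε hε
    refine (diff_bound hg hε t).trans ?_
    have hms : AEMeasurable (fun s => ‖g s - g t‖ₑ) volume :=
      (hg.aestronglyMeasurable.sub aestronglyMeasurable_const).enorm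
    calc ∫⁻ s, ENNReal.ofReal (PK ε (t - s)) * ‖g s - g t‖ₑ 
        ≤ ∫⁻ s, ∑' k : ℕ, (Metric.closedBall t (2 ^ k * ε)).indicator
            (fun s => ENNReal.ofReal (4 * (1 / 4) ^ k / ε) * ‖g s - g t‖ₑ) s := by
          refine lintegral_mono fun s => ?_
          obtain ⟨k, hk1, hk2⟩ := PK_le' hε (t - s)
          refine le_trans ?_ (ENNReal.le_tsum k)
          rw [Set.indicator_of_mem]
          · gcongr
          · rw [Metric.mem_closedBall, dist_comm, Real.dist_eq]; exact hk1
      _ = ∑' k : ℕ, ENNReal.ofReal (8 * (1 / 2 : ℝ) ^ k * D (2 ^ k * ε)) := by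
          rw [lintegral_tsum]
          · congr 1; ext k
            rw [lintegral_indicator Metric.isClosed_closedBall.measurableSet, lintegral_const_mul' _ _ ENNReal.ofReal_ne_top,
              hDl _ (by positivity), ← ENNReal.ofReal_mul (by positivity)]
            congr 1
            have : (1 / 4 : ℝ) ^ k = (1 / 2) ^ k * (1 / 2) ^ k := by rw [← mul_pow]; norm_num
            have h2 : (1 / 2 : ℝ) ^ k * 2 ^ k = 1 := by rw [← mul_pow]; norm_num
            rw [this]
            generalize D (2 ^ k * ε) = y
            field_simp
            linear_combination (4 * 2) * y * h2
          · intro k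
            exact (hms.const_mul _).indicator Metric.isClosed_closedBall.measurableSet
      _ = _ := by
          rw [ENNReal.ofReal_tsum_of_nonneg]
          · intro k; have := hD0 (2 ^ k * ε); positivity
          · refine Summable.of_nonneg_of_le (fun k => ?_) (fun k => ?_) hsum
            · have := hD0 (2 ^ k * ε); positivity
            · gcongr; exact hB _ (by positivity)
  rw [tendsto_iff_edist_tendsto_0]
  refine tendsto_of_tendsto_of_tendsto_of_le_of_le' tendsto_const_nhds
    (by rw [← ENNReal.ofReal_zero]; exact ENNReal.tendsto_ofReal hlim) (Eventually.of_forall fun _ => zero_le) ?_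
  filter_upwards [self_mem_nhdsWithin] with ε hε
  rw [edist_eq_enorm_sub]
  exact hbound ε hε

lemma transl {g : ℝ → ℂ} (hg : Integrable g) :
    Tendsto (fun u : ℝ => eLpNorm (fun t => g (t - u) - g t) 1 volume) (nhds 0) (nhds 0) := by
  have hm : MemLp g 1 volume := memLp_one_iff_integrable.2 hg
  have : Fact ((1 : ℝ≥0∞) ≤ 1) := ⟨le_rfl⟩
  have : Fact ((1 : ℝ≥0∞) ≠ ⊤) := ⟨ENNReal.one_ne_top⟩
  have hc : Tendsto (fun u : ℝ => (DomAddAct.mk (-u)) +ᵥ (hm.toLp g)) (nhds 0) (nhds (hm.toLp g)) := by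
    have h1 : Continuous (fun u : ℝ => (DomAddAct.mk (-u)) +ᵥ (hm.toLp g)) := by
      have h2 : Continuous fun u : ℝ => DomAddAct.mk (-u) :=
        DomAddAct.continuous_mk.comp continuous_neg
      exact h2.vadd continuous_const
    have := h1.tendsto 0
    simpa using this
  rw [tendsto_iff_edist_tendsto_0] at hc
  refine hc.congr fun u => ?_
  rw [DomAddAct.mk_vadd_toLp, Lp.edist_toLp_toLp]
  congr 1
  ext t
  simp [sub_eq_neg_add]

lemma l1conv_aux {g : ℝ → ℂ} (hg : Integrable g) (hgm : Measurable g) :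
    Tendsto (fun ε : ℝ => eLpNorm (fun t => (∫ s, (PK ε (t - s) : ℂ) * g s) - g t) 1 volume)
      (nhdsWithin 0 (Set.Ioi 0)) (nhds 0) := by
  set τ : ℝ → ℝ≥0∞ := fun u => ∫⁻ t, ‖g (t - u) - g t‖ₑ with hτ
  have hτ0 : Tendsto τ (nhds 0) (nhds 0) := by
    have := transl hg
    simpa only [eLpNorm_one_eq_lintegral_enorm] using this
  have hτm : Measurable τ := by
    refine Measurable.lintegral_prod_right' (f := fun p : ℝ × ℝ => ‖g (p.2 - p.1) - g p.2‖ₑ) ?_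
    fun_prop
  set N := ∫⁻ t, ‖g t‖ₑ with hN
  have hNf : N ≠ ⊤ := hg.hasFiniteIntegral.ne
  have hτb : ∀ u, τ u ≤ N + N := by
    intro u
    calc τ u ≤ ∫⁻ t, (‖g (t - u)‖ₑ + ‖g t‖ₑ) := lintegral_mono fun t => enorm_sub_le
      _ = N + N := by
        rw [lintegral_add_right _ hgm.enorm]
        congr 1
        exact lintegral_sub_right_eq_self (fun t => ‖g t‖ₑ) u
  have hbound : ∀ ε : ℝ, 0 < ε → eLpNorm (fun t => (∫ s, (PK ε (t - s) : ℂ) * g s) - g t) 1 volume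
      ≤ ∫⁻ v, ENNReal.ofReal (PK 1 v) * τ (ε * v) := by
    intro ε hε
    have hPm : Measurable (PK ε) := (PK_cont hε).measurable
    rw [eLpNorm_one_eq_lintegral_enorm]
    calc _ ≤ ∫⁻ t, ∫⁻ s, ENNReal.ofReal (PK ε (t - s)) * ‖g s - g t‖ₑ :=
          lintegral_mono fun t => diff_bound hg hε t
      _ = ∫⁻ t, ∫⁻ u, ENNReal.ofReal (PK ε u) * ‖g (t - u) - g t‖ₑ := by
          congr 1; ext t
          rw [← lintegral_sub_left_eq_self _ t]
          simp
      _ = ∫⁻ u, ∫⁻ t, ENNReal.ofReal (PK ε u) * ‖g (t - u) - g t‖ₑ := by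
          refine lintegral_lintegral_swap ?_
          apply Measurable.aemeasurable
          simp only [Function.uncurry_def]
          fun_prop
      _ = ∫⁻ u, ENNReal.ofReal (PK ε u) * τ u := by
          congr 1; ext u
          rw [lintegral_const_mul' _ _ ENNReal.ofReal_ne_top]
      _ = ENNReal.ofReal ε * ∫⁻ v, ENNReal.ofReal (PK ε (ε * v)) * τ (ε * v) := by
          conv_lhs => rw [← Real.smul_map_volume_mul_left hε.ne']
          rw [lintegral_smul_measure, lintegral_map (by fun_prop) (by fun_prop), abs_of_pos hε]
          rfl
      _ = _ := by
          rw [← lintegral_const_mul' _ _ ENNReal.ofReal_ne_top]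
          congr 1; ext v
          rw [← mul_assoc, ← ENNReal.ofReal_mul hε.le, PK_scale hε]
  refine tendsto_of_tendsto_of_tendsto_of_le_of_le' tendsto_const_nhds
    (h := fun ε => ∫⁻ v, ENNReal.ofReal (PK 1 v) * τ (ε * v)) ?_ (Eventually.of_forall fun _ => zero_le) ?_
  · have hPm : Measurable (PK 1) := (PK_cont one_pos).measurable
    have := tendsto_lintegral_filter_of_dominated_convergence (μ := volume)
      (l := nhdsWithin (0:ℝ) (Set.Ioi 0))
      (F := fun ε v => ENNReal.ofReal (PK 1 v) * τ (ε * v)) (f := fun _ => 0)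
      (fun v => ENNReal.ofReal (PK 1 v) * (N + N)) ?_ ?_ ?_ ?_
    · simpa using this
    · exact Eventually.of_forall fun ε => by fun_prop
    · exact Eventually.of_forall fun ε => Eventually.of_forall fun v => by
        have := hτb (ε * v)
        gcongr
    · rw [lintegral_mul_const _ (by fun_prop)]
      refine ENNReal.mul_ne_top ?_ (by simp [hNf])
      rw [← ofReal_integral_eq_lintegral_ofReal PK1_integrable (Eventually.of_forall (PK_nonneg one_pos))]
      exact ENNReal.ofReal_ne_top
    · refine Eventually.of_forall fun v => ?_
      have h1 : Tendsto (fun ε : ℝ => ε * v) (nhdsWithin 0 (Set.Ioi 0)) (nhds 0) := by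
        refine Tendsto.mono_left ?_ nhdsWithin_le_nhds
        have : Continuous fun ε : ℝ => ε * v := by fun_prop
        simpa using this.tendsto 0
      simpa using ENNReal.Tendsto.const_mul (hτ0.comp h1) (Or.inr ENNReal.ofReal_ne_top)
  · filter_upwards [self_mem_nhdsWithin] with ε hε
    exact hbound ε hε

lemma l1conv {g : ℝ → ℂ} (hg : Integrable g) :
    Tendsto (fun ε : ℝ => eLpNorm (fun t => (∫ s, (PK ε (t - s) : ℂ) * g s) - g t) 1 volume)
      (nhdsWithin 0 (Set.Ioi 0)) (nhds 0) := by
  have hae := hg.aestronglyMeasurable.ae_eq_mk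
  have h := l1conv_aux (hg.congr hae) hg.aestronglyMeasurable.stronglyMeasurable_mk.measurable
  refine h.congr fun ε => ?_
  refine eLpNorm_congr_ae ?_
  filter_upwards [hae] with t ht
  rw [← ht]
  congr 1
  refine integral_congr_ae ?_
  filter_upwards [hae] with s hs
  rw [← hs]

theorem frft_abel_means_convergence (α : ℝ) (hα : ∀ n : ℤ, α ≠ n * Real.pi)
    (f : ℝ → ℂ) (hf : Integrable f) :
    Tendsto (fun ε : ℝ => eLpNorm (fun t => abelMean α f ε t - f t) 1 volume)
        (nhdsWithin 0 (Set.Ioi 0)) (nhds 0) ∧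
      ∀ᵐ t : ℝ, Tendsto (fun ε : ℝ => abelMean α f ε t)
        (nhdsWithin 0 (Set.Ioi 0)) (nhds (f t)) := by
  have hs : Real.sin α ≠ 0 := by
    intro h
    obtain ⟨n, hn⟩ := Real.sin_eq_zero_iff.1 h
    exact hα n hn.symm
  set g : ℝ → ℂ := fun s => cexp (Complex.I * ((π * Real.cot α * s ^ 2 : ℝ) : ℂ)) * f s with hg
  have hgi : Integrable g := by
    refine Integrable.bdd_mul (c := 1) hf ?_ ?_
    · apply Continuous.aestronglyMeasurable
      fun_prop
    · refine Eventually.of_forall fun p => ?_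
      rw [Complex.norm_exp_I_mul_ofReal]
  have hfg : ∀ t, f t = cexp (Complex.I * ((-(π * Real.cot α * t ^ 2) : ℝ) : ℂ)) * g t := by
    intro t
    simp only [hg]
    rw [← mul_assoc, ← Complex.exp_add, ← mul_add, ← Complex.ofReal_add, neg_add_cancel]
    simp
  constructor
  · refine (l1conv hgi).congr' ?_
    filter_upwards [self_mem_nhdsWithin] with ε hε
    rw [eLpNorm_one_eq_lintegral_enorm, eLpNorm_one_eq_lintegral_enorm]
    congr 1; ext t
    rw [abelMean_eq α hs f hf ε hε t, hfg t, ← mul_sub, enorm_mul]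
    have : ‖cexp (Complex.I * ((-(π * Real.cot α * t ^ 2) : ℝ) : ℂ))‖ₑ = 1 := by
      rw [← ofReal_norm, Complex.norm_exp_I_mul_ofReal, ENNReal.ofReal_one]
    rw [this, one_mul]
  · filter_upwards [IsUnifLocDoublingMeasure.ae_tendsto_average_norm_sub volume
      hgi.locallyIntegrable 1] with t ht
    have h1 := ptwise hgi t (ht (fun _ => t) (fun r => r) tendsto_id (by
      filter_upwards [self_mem_nhdsWithin] with r (hr : 0 < r)
      simpa using hr.le))
    rw [hfg t]
    refine (h1.const_mul _).congr' ?_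
    filter_upwards [self_mem_nhdsWithin] with ε hε
    rw [abelMean_eq α hs f hf ε hε t]
end

section
/- (FRFT inversion) Let α not be an integer multiple of π. If both f and F_α f belong to L^1(R), then f(t) = ∫_R (F_α f)(x) K_{−α}(x,t) dx for almost every t ∈ R. -/
open MeasureTheory Complex Real Filter
open scoped ENNReal

open scoped FourierTransform SchwartzMap ContDiff in
lemma fourier_inv_ae (g : ℝ → ℂ) (hg : Integrable g) (hFg : Integrable (𝓕 g)) :
    ∀ᵐ t : ℝ, g t = 𝓕⁻ (𝓕 g) t := by
  have flip : ∀ (u v : ℝ → ℂ), Integrable u → Integrable v →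
      ∫ x, 𝓕 u x * v x = ∫ x, u x * 𝓕 v x := by
    intro u v hu hv
    simpa using! VectorFourier.integral_fourierIntegral_smul_eq_flip (L := innerₗ ℝ)
      Real.continuous_fourierChar continuous_inner hu hv
  have hcont : Continuous (𝓕⁻ (𝓕 g)) := by
    have h1 : Continuous (𝓕 (𝓕 g)) :=
      VectorFourier.fourierIntegral_continuous Real.continuous_fourierChar
        (innerSL ℝ).continuous₂ hFg
    have h2 : (𝓕⁻ (𝓕 g)) = fun v => 𝓕 (𝓕 g) (-v) := by
      ext v; exact fourierInv_eq_fourier_neg _ _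
    rw [h2]; exact h1.comp continuous_neg
  refine ae_eq_of_integral_contDiff_smul_eq hg.locallyIntegrable hcont.locallyIntegrable ?_
  intro φ hφ hφc
  let Φ : 𝓢(ℝ, ℂ) := (HasCompactSupport.comp_left hφc (g := ((↑) : ℝ → ℂ)) (by simp)).toSchwartzMap
    (Complex.ofRealCLM.contDiff.comp hφ)
  have hΦ : ∀ x, Φ x = (φ x : ℂ) := fun x => rfl
  have key : ∫ x, Φ x * g x = ∫ x, Φ x * 𝓕⁻ (𝓕 g) x := by
    have e1 : ∫ x, Φ x * g x = ∫ x, (𝓕⁻ Φ) x * 𝓕 g x := by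
      rw [← flip _ _ (𝓕⁻ Φ).integrable hg, ← SchwartzMap.fourier_coe,
        FourierTransform.fourier_fourierInv_eq]
    have e2 : ∫ x, Φ x * 𝓕⁻ (𝓕 g) x = ∫ x, 𝓕 (Φ : ℝ → ℂ) x * 𝓕 g (-x) := by
      rw [fourierInv_eq_fourier_comp_neg]
      exact (flip _ _ Φ.integrable hFg.comp_neg).symm
    rw [e1, e2, ← integral_neg_eq_self]
    congr 1; ext x
    rw [SchwartzMap.fourierInv_coe, fourierInv_eq_fourier_neg, neg_neg]
  simpa [hΦ] using key

open scoped FourierTransform in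
theorem frft_inversion (α : ℝ) (hα : ∀ n : ℤ, α ≠ n * Real.pi)
    (f : ℝ → ℂ) (hf : Integrable f) (hFf : Integrable (frft α f)) :
    ∀ᵐ t : ℝ, f t = ∫ x : ℝ, frft α f x * frftKernel (-α) x t := by
  have hs : Real.sin α ≠ 0 := by
    intro h
    obtain ⟨n, hn⟩ := Real.sin_eq_zero_iff.1 h
    exact hα n hn.symm
  have hAA := Aa_mul α hs
  set s : ℝ := (Real.sin α)⁻¹ with hsdef
  have hs0 : s ≠ 0 := inv_ne_zero hs
  have hA : Aa α ≠ 0 := by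
    intro h
    rw [h, zero_mul] at hAA
    exact hs0 (by simpa using hAA.symm)
  set c : ℝ := Real.cot α with hc
  have hcn : Real.cot (-α) = -c := by
    simp [hc, Real.cot_eq_cos_div_sin, div_neg]
  let e : ℝ → ℂ := fun t => Complex.exp (((π * c * t ^ 2 : ℝ) : ℂ) * I)
  have he1 : ∀ t, ‖e t‖ = 1 := fun t => Complex.norm_exp_ofReal_mul_I _
  have hec : Continuous e := by fun_prop
  let e' : ℝ → ℂ := fun t => Complex.exp (-(((π * c * t ^ 2 : ℝ) : ℂ) * I))
  have hee : ∀ t, e t * e' t = 1 := fun t => by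
    simp only [e, e', ← Complex.exp_add]; simp
  have he1' : ∀ t, ‖e' t‖ = 1 := fun t => by
    have := congrArg norm (hee t)
    rwa [norm_mul, he1, one_mul, norm_one] at this
  have hec' : Continuous e' := by fun_prop
  let g : ℝ → ℂ := fun t => e t * f t
  have hg : Integrable g := hf.bdd_mul (c := 1) hec.aestronglyMeasurable
    (Eventually.of_forall fun t => (he1 t).le)
  have hF : ∀ x, frft α f x = Aa α * e x * 𝓕 g (s * x) := by
    intro x
    rw [fourier_real_eq_integral_exp_smul, ← integral_const_mul]
    unfold frft frftKernel
    congr 1; ext t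
    simp only [g, e, smul_eq_mul]
    rw [← hc, ← Complex.ofReal_inv, ← hsdef]
    have : Complex.exp (2 * π * I * ((t : ℂ)^2/2 * (c : ℂ) - x * t * (s : ℂ) + (x : ℂ)^2/2 * c))
      = Complex.exp (((π * c * x ^ 2 : ℝ) : ℂ) * I) *
        Complex.exp (((-2 * π * t * (s * x) : ℝ) : ℂ) * I) *
        Complex.exp (((π * c * t ^ 2 : ℝ) : ℂ) * I) := by
      rw [← Complex.exp_add, ← Complex.exp_add]
      congr 1; push_cast; ring
    rw [this]; ring
  have hFg : Integrable (𝓕 g) := by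
    rw [← integrable_comp_mul_left_iff (𝓕 g) hs0]
    have h1 : Integrable (fun x => e' x * frft α f x) :=
      hFf.bdd_mul (c := 1) hec'.aestronglyMeasurable
        (Eventually.of_forall fun t => (he1' t).le)
    refine (h1.const_mul (Aa α)⁻¹).congr (Eventually.of_forall fun x => ?_)
    simp only [hF]
    field_simp
    linear_combination 𝓕 g (s * x) * hee x
  filter_upwards [fourier_inv_ae g hg hFg] with t ht
  have hint : ∀ x, frft α f x * frftKernel (-α) x t =
      (|s| : ℝ) * e' t * (fun y : ℝ => Complex.exp (((2 * π * (y * t) : ℝ) : ℂ) * I) * 𝓕 g y) (s * x) := by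
    intro x
    rw [hF, ← hAA]
    unfold frftKernel
    rw [hcn, Real.sin_neg, Complex.ofReal_neg, Complex.ofReal_neg, inv_neg, ← Complex.ofReal_inv,
      ← hsdef]
    have : Complex.exp (2 * π * I * ((t : ℂ)^2/2 * -(c : ℂ) - x * t * -(s : ℂ) + (x : ℂ)^2/2 * -(c : ℂ)))
      = e' x * e' t * Complex.exp (((2 * π * (s * x * t) : ℝ) : ℂ) * I) := by
      simp only [e']
      rw [← Complex.exp_add, ← Complex.exp_add]
      congr 1; push_cast; ring
    rw [this]
    linear_combination (Aa α * Aa (-α) * e' t * Complex.exp (((2 * π * (s * x * t) : ℝ) : ℂ) * I) * 𝓕 g (s * x)) * hee x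
  rw [integral_congr_ae (Eventually.of_forall hint)]
  rw [integral_const_mul, Measure.integral_comp_mul_left
    (fun y : ℝ => Complex.exp (((2 * π * (y * t) : ℝ) : ℂ) * I) * 𝓕 g y) s]
  have hI : ∫ y : ℝ, Complex.exp (((2 * π * (y * t) : ℝ) : ℂ) * I) * 𝓕 g y = g t := by
    rw [ht, fourierInv_eq']
    congr 1; ext y
    simp [mul_comm]
  have hinv : ((|s⁻¹| : ℝ) : ℂ) * ((|s| : ℝ) : ℂ) = 1 := by
    rw [← Complex.ofReal_mul, ← abs_mul, inv_mul_cancel₀ hs0]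
    simp
  rw [hI, Complex.real_smul]
  change f t = _ * (_ * (e t * f t))
  linear_combination (-f t) * hee t - (e t * e' t * f t) * hinv
end
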